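/- For every w ∈ (0,1) the measure ν_w is doubling on K: there exists a constant C ≥ 1 such that ν_w(B(x,2r)) ≤ C ν_w(B(x,r)) for every x ∈ K and every r > 0, where B(x,r) denotes the open ball in ℝ centered at x of radius r. -/

import Mathlib

open MeasureTheory Filter Set Metric
open scoped ENNReal Topology

noncomputable section

/-- The map `π : Σ = {0,1}^ℕ → ℝ` (with `false` representing the digit 0 and `true`
representing the digit 1, coordinates indexed from 0), `π(a) = ∑_{i} 2 aᵢ 3^{-(i+1)}`. -/
def cantorPi (a : ℕ → Bool) : ℝ := ∑' i : ℕ, (if a i then 2 else 0) / 3 ^ (i + 1)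

/-- The middle-third Cantor set `K = π(Σ)`. -/
def cantorK : Set ℝ := Set.range cantorPi

/-- The similar copy `K_a` of `K` determined by a finite binary string `a` of length `N`. -/
def cantorCyl {N : ℕ} (a : Fin N → Bool) : Set ℝ :=
  cantorPi '' {b : ℕ → Bool | ∀ i : Fin N, b i = a i}

/-- The number of zeros in the finite binary string `a`. -/
def zeros {N : ℕ} (a : Fin N → Bool) : ℕ := (Finset.univ.filter fun i => a i = false).card

/-- One step of the Bernoulli(w) shift map on `[0,1)`. -/
def bernStep (w x : ℝ) : ℝ := if x < w then x / w else (x - w) / (1 - w)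

/-- The Bernoulli(w) digit sequence of `x ∈ [0,1)`: digit `n` is `false` (i.e. 0)
iff the `n`-th iterate of the Bernoulli shift lies in `[0,w)`. -/
def bernDigits (w x : ℝ) : ℕ → Bool := fun n => decide (w ≤ (bernStep w)^[n] x)

/-- The Bernoulli product probability measure `ν_{w,Σ}` on `Σ = {0,1}^ℕ`, under which the
coordinates are i.i.d. with mass `w` on 0 (= `false`) and mass `1-w` on 1 (= `true`);
realized as the law of the Bernoulli(w) digit sequence of a uniform point of `[0,1)`. -/
def bernMeasure (w : ℝ) : Measure (ℕ → Bool) :=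
  Measure.map (bernDigits w) (volume.restrict (Set.Ico (0:ℝ) 1))

/-- The measure `ν_w = π_* ν_{w,Σ}` on `ℝ`, concentrated on `K`. -/
def nu (w : ℝ) : Measure ℝ := (bernMeasure w).map cantorPi

/-- The inverse branch of the Bernoulli shift with digit `b`. -/
def bernBranch (w : ℝ) (b : Bool) (x : ℝ) : ℝ := cond b w 0 + cond b (1 - w) w * x

/-- The contraction of the Cantor set onto its left (`false`) or right (`true`) third. -/
def cantorBranch (b : Bool) (x : ℝ) : ℝ := (x + cond b 2 0) / 3

lemma cantorPi_term_nonneg (a : ℕ → Bool) (i : ℕ) :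
    0 ≤ (if a i then (2 : ℝ) else 0) / 3 ^ (i + 1) := by
  split_ifs <;> positivity

lemma cantorPi_term_le (a : ℕ → Bool) (i : ℕ) :
    (if a i then (2 : ℝ) else 0) / 3 ^ (i + 1) ≤ 2 / 3 * (1 / 3) ^ i := by
  have h : (2 / 3 * (1 / 3) ^ i : ℝ) = 2 / 3 ^ (i + 1) := by
    rw [pow_succ, one_div_pow]; field_simp
  rw [h]
  gcongr
  split_ifs <;> norm_num

lemma hasSum_two_thirds_geometric : HasSum (fun i : ℕ => (2 / 3 * (1 / 3) ^ i : ℝ)) 1 := by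
  have := (hasSum_geometric_of_lt_one (r := (1 / 3 : ℝ)) (by norm_num) (by norm_num)).mul_left
    (2 / 3)
  norm_num at this ⊢
  exact this

lemma summable_cantorPi (a : ℕ → Bool) :
    Summable fun i : ℕ => (if a i then (2 : ℝ) else 0) / 3 ^ (i + 1) :=
  hasSum_two_thirds_geometric.summable.of_nonneg_of_le (cantorPi_term_nonneg a)
    (cantorPi_term_le a)

lemma cantorPi_mem_Icc (a : ℕ → Bool) : cantorPi a ∈ Icc (0 : ℝ) 1 :=
  ⟨tsum_nonneg (cantorPi_term_nonneg a), hasSum_two_thirds_geometric.tsum_eq ▸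
    (summable_cantorPi a).tsum_le_tsum (cantorPi_term_le a)
      hasSum_two_thirds_geometric.summable⟩

lemma cantorPi_eq_cantorBranch (a : ℕ → Bool) :
    cantorPi a = cantorBranch (a 0) (cantorPi fun n => a (n + 1)) := by
  unfold cantorPi cantorBranch
  rw [(summable_cantorPi a).tsum_eq_zero_add, add_div, ← tsum_div_const, add_comm]
  congr 1
  · refine tsum_congr fun i => ?_
    rw [pow_succ (3 : ℝ) (i + 1), div_div]
  · cases a 0 <;> simp

lemma continuous_cantorPi : Continuous cantorPi := by
  refine continuous_tsum (fun i => ?_) hasSum_two_thirds_geometric.summable fun i a => ?_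
  · exact (continuous_of_discreteTopology (f := fun b : Bool =>
      (if b then (2 : ℝ) else 0) / 3 ^ (i + 1))).comp (continuous_apply i)
  · rw [Real.norm_of_nonneg (cantorPi_term_nonneg a i)]
    exact cantorPi_term_le a i

lemma measurable_bernStep (w : ℝ) : Measurable (bernStep w) :=
  Measurable.ite measurableSet_Iio (by fun_prop) (by fun_prop)

lemma measurable_bernDigits (w : ℝ) : Measurable (bernDigits w) := by
  refine measurable_pi_lambda _ fun n => measurable_to_bool ?_
  have : (fun x => bernDigits w x n) ⁻¹' {true} = (bernStep w)^[n] ⁻¹' Ici w := by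
    ext x; simp [bernDigits]
  rw [this]
  exact (measurable_bernStep w).iterate n measurableSet_Ici

lemma measurable_cantorPi_bernDigits (w : ℝ) : Measurable fun x => cantorPi (bernDigits w x) :=
  continuous_cantorPi.measurable.comp (measurable_bernDigits w)

lemma nu_eq_map (w : ℝ) :
    nu w = (volume.restrict (Ico (0 : ℝ) 1)).map fun x => cantorPi (bernDigits w x) :=
  Measure.map_map continuous_cantorPi.measurable (measurable_bernDigits w)

lemma nu_apply (w : ℝ) {A : Set ℝ} (hA : MeasurableSet A) :
    nu w A = volume ({x | cantorPi (bernDigits w x) ∈ A} ∩ Ico (0 : ℝ) 1) := by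
  have h := measurable_cantorPi_bernDigits w
  rw [nu_eq_map, Measure.map_apply h hA, Measure.restrict_apply (h hA)]
  rfl

lemma nu_le_one (w : ℝ) {A : Set ℝ} (hA : MeasurableSet A) : nu w A ≤ 1 := by
  rw [nu_apply w hA]
  exact (measure_mono inter_subset_right).trans (by simp)

lemma nu_eq_one (w : ℝ) {A : Set ℝ} (hA : MeasurableSet A) (h : Icc (0 : ℝ) 1 ⊆ A) :
    nu w A = 1 := by
  rw [nu_apply w hA, inter_eq_right.2 fun x _ => mem_ofPred.2 (h (cantorPi_mem_Icc _))]
  simp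

lemma nu_eq_zero (w : ℝ) {A : Set ℝ} (hA : MeasurableSet A) (h : Disjoint A (Icc (0 : ℝ) 1)) :
    nu w A = 0 := by
  rw [nu_apply w hA]
  convert measure_empty (μ := volume)
  ext x
  simpa using fun hx => absurd (cantorPi_mem_Icc (bernDigits w x)) (disjoint_left.1 h hx)

section Branches

variable {w : ℝ}

lemma bernStep_bernBranch (hw : w ∈ Ioo (0 : ℝ) 1) (b : Bool) {x : ℝ} (hx : x ∈ Ico (0 : ℝ) 1) :
    bernStep w (bernBranch w b x) = x := by
  obtain ⟨h0, h1⟩ := hw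
  obtain ⟨hx0, hx1⟩ := hx
  have h2 : 1 - w ≠ 0 := by linarith
  cases b
  · have : w * x < w := by nlinarith
    simp [bernBranch, bernStep, this, h0.ne']
  · have : ¬ (w + (1 - w) * x < w) := by nlinarith
    have h3 : bernBranch w true x = w + (1 - w) * x := rfl
    rw [h3, bernStep, if_neg this]
    field_simp
    ring

lemma le_bernBranch_iff (hw : w ∈ Ioo (0 : ℝ) 1) (b : Bool) {x : ℝ} (hx : x ∈ Ico (0 : ℝ) 1) :
    w ≤ bernBranch w b x ↔ b = true := by
  obtain ⟨h0, h1⟩ := hw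
  obtain ⟨hx0, hx1⟩ := hx
  cases b <;> simp only [bernBranch, cond_true, cond_false, iff_true, Bool.false_eq_true,
    iff_false, not_le] <;> nlinarith

lemma cantorPi_bernDigits_bernBranch (hw : w ∈ Ioo (0 : ℝ) 1) (b : Bool) {x : ℝ}
    (hx : x ∈ Ico (0 : ℝ) 1) :
    cantorPi (bernDigits w (bernBranch w b x)) = cantorBranch b (cantorPi (bernDigits w x)) := by
  rw [cantorPi_eq_cantorBranch]
  congr 2
  · simp [bernDigits, le_bernBranch_iff hw b hx]
  · funext n
    simp [bernDigits, Function.iterate_succ_apply, bernStep_bernBranch hw b hx]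

lemma bernBranch_mem_iff (hw : w ∈ Ioo (0 : ℝ) 1) (b : Bool) {x : ℝ} :
    bernBranch w b x ∈ Ico (cond b w 0) (cond b 1 w) ↔ x ∈ Ico (0 : ℝ) 1 := by
  obtain ⟨h0, h1⟩ := hw
  have h2 : 0 < 1 - w := by linarith
  cases b <;> simp only [bernBranch, cond_true, cond_false, mem_Ico] <;>
    constructor <;> rintro ⟨h3, h4⟩ <;> constructor <;> nlinarith

/-- Scaling of the Lebesgue measure under an inverse branch of the Bernoulli shift. -/
lemma volume_preimage_bernBranch (hw : w ∈ Ioo (0 : ℝ) 1) (b : Bool) (E : Set ℝ) :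
    ENNReal.ofReal (cond b (1 - w) w) * volume (bernBranch w b ⁻¹' E) = volume E := by
  have hp : 0 < cond b (1 - w) w := by cases b <;> simp [hw.1, hw.2]
  have : bernBranch w b ⁻¹' E =
      (fun x => cond b (1 - w) w * x) ⁻¹' ((fun x => cond b w 0 + x) ⁻¹' E) := rfl
  rw [this, Real.volume_preimage_mul_left hp.ne', measure_preimage_add, ← mul_assoc,
    ← ENNReal.ofReal_mul hp.le, abs_of_pos (inv_pos.2 hp), mul_inv_cancel₀ hp.ne',
    ENNReal.ofReal_one, one_mul]

lemma nu_preimage_cantorBranch (hw : w ∈ Ioo (0 : ℝ) 1) (b : Bool) {A : Set ℝ}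
    (hA : MeasurableSet A) :
    ENNReal.ofReal (cond b (1 - w) w) * nu w (cantorBranch b ⁻¹' A) =
      volume ({x | cantorPi (bernDigits w x) ∈ A} ∩ Ico (cond b w 0) (cond b 1 w)) := by
  have hm : Measurable (cantorBranch b) := by unfold cantorBranch; fun_prop
  rw [nu_apply w (hm hA), ← volume_preimage_bernBranch hw b (_ ∩ Ico (cond b w 0) _)]
  congr 2
  apply Set.ext
  intro x
  simp only [mem_inter_iff, mem_preimage, mem_ofPred_eq, bernBranch_mem_iff hw]
  refine and_congr_left fun hx => ?_
  rw [cantorPi_bernDigits_bernBranch hw b hx]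

/-- The self-similarity of `ν_w`. -/
lemma nu_self_similar (hw : w ∈ Ioo (0 : ℝ) 1) (b : Bool) {A : Set ℝ} (hA : MeasurableSet A) :
    nu w A = ENNReal.ofReal (cond b (1 - w) w) * nu w (cantorBranch b ⁻¹' A) +
      ENNReal.ofReal (cond (!b) (1 - w) w) * nu w (cantorBranch (!b) ⁻¹' A) := by
  have key : nu w A = ENNReal.ofReal w * nu w (cantorBranch false ⁻¹' A) +
      ENNReal.ofReal (1 - w) * nu w (cantorBranch true ⁻¹' A) := by
    have h0 := nu_preimage_cantorBranch hw false hA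
    have h1 := nu_preimage_cantorBranch hw true hA
    simp only [cond_true, cond_false] at h0 h1
    rw [h0, h1, nu_apply w hA, ← measure_union, ← inter_union_distrib_left,
      Ico_union_Ico_eq_Ico hw.1.le hw.2.le]
    · exact (Ico_disjoint_Ico_same).mono inter_subset_right inter_subset_right
    · exact (measurable_cantorPi_bernDigits w hA).inter measurableSet_Ico
  cases b
  · simpa using key
  · simpa [add_comm] using key

lemma cantorBranch_preimage_ball (b : Bool) (x r : ℝ) :
    cantorBranch b ⁻¹' ball (cantorBranch b x) r = ball x (3 * r) := by
  ext y
  have : cantorBranch b y - cantorBranch b x = (y - x) / 3 := by unfold cantorBranch; ring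
  simp only [mem_preimage, mem_ball, Real.dist_eq, this, abs_div]
  rw [abs_of_pos (by norm_num : (0 : ℝ) < 3), div_lt_iff₀ (by norm_num), mul_comm]

lemma le_nu_ball_cantorBranch (hw : w ∈ Ioo (0 : ℝ) 1) (b : Bool) (x r : ℝ) :
    ENNReal.ofReal (cond b (1 - w) w) * nu w (ball x (3 * r)) ≤
      nu w (ball (cantorBranch b x) r) := by
  rw [nu_self_similar hw b (A := ball (cantorBranch b x) r) measurableSet_ball,
    cantorBranch_preimage_ball]
  exact le_self_add

lemma nu_ball_cantorBranch (hw : w ∈ Ioo (0 : ℝ) 1) (b : Bool) {x r : ℝ}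
    (hx : x ∈ Icc (0 : ℝ) 1) (hr : r ≤ 1 / 3) :
    nu w (ball (cantorBranch b x) r) =
      ENNReal.ofReal (cond b (1 - w) w) * nu w (ball x (3 * r)) := by
  have hm : Measurable (cantorBranch (!b)) := by unfold cantorBranch; fun_prop
  rw [nu_self_similar hw b measurableSet_ball, cantorBranch_preimage_ball,
    nu_eq_zero w (hm measurableSet_ball), mul_zero, add_zero]
  refine disjoint_left.2 fun y hy hy' => ?_
  obtain ⟨hx0, hx1⟩ := hx
  obtain ⟨hy0, hy1⟩ := hy'
  rw [mem_preimage, mem_ball, Real.dist_eq, abs_lt] at hy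
  cases b <;> simp only [cantorBranch, Bool.not_true, Bool.not_false, cond_true,
    cond_false] at hy <;> linarith [hy.1, hy.2]

lemma cantorK_exists_branch {x : ℝ} (hx : x ∈ cantorK) :
    ∃ b, ∃ y ∈ cantorK, x = cantorBranch b y := by
  obtain ⟨a, rfl⟩ := hx
  exact ⟨a 0, _, ⟨_, rfl⟩, cantorPi_eq_cantorBranch a⟩

lemma cantorK_subset_Icc : cantorK ⊆ Icc (0 : ℝ) 1 := by
  rintro _ ⟨a, rfl⟩
  exact cantorPi_mem_Icc a

/-- A uniform lower bound for the mass of balls of radius larger than `1 / 9`. -/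
lemma sq_le_nu_ball (hw : w ∈ Ioo (0 : ℝ) 1) {x r : ℝ} (hx : x ∈ cantorK) (hr : 1 / 9 < r) :
    ENNReal.ofReal (min w (1 - w)) ^ 2 ≤ nu w (ball x r) := by
  have hmin (b : Bool) :
      ENNReal.ofReal (min w (1 - w)) ≤ ENNReal.ofReal (cond b (1 - w) w) := by
    apply ENNReal.ofReal_le_ofReal
    cases b <;> simp
  obtain ⟨b, y, hy, rfl⟩ := cantorK_exists_branch hx
  obtain ⟨c, z, hz, rfl⟩ := cantorK_exists_branch hy
  have h1 : nu w (ball z (3 * (3 * r))) = 1 := by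
    refine nu_eq_one w measurableSet_ball fun t ht => ?_
    obtain ⟨hz0, hz1⟩ := cantorK_subset_Icc hz
    rw [mem_ball, Real.dist_eq, abs_lt]
    constructor <;> linarith [ht.1, ht.2]
  calc ENNReal.ofReal (min w (1 - w)) ^ 2
      ≤ ENNReal.ofReal (cond b (1 - w) w) *
        (ENNReal.ofReal (cond c (1 - w) w) * nu w (ball z (3 * (3 * r)))) := by
        rw [h1, mul_one, sq]
        exact mul_le_mul' (hmin b) (hmin c)
    _ ≤ ENNReal.ofReal (cond b (1 - w) w) * nu w (ball (cantorBranch c z) (3 * r)) := by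
        gcongr
        exact le_nu_ball_cantorBranch hw c z (3 * r)
    _ ≤ _ := le_nu_ball_cantorBranch hw b _ r

end Branches

/-- For every `w ∈ (0,1)` the measure `ν_w` is doubling on `K`: there is a constant `C ≥ 1`
with `ν_w(B(x,2r)) ≤ C ν_w(B(x,r))` for every `x ∈ K` and every `r > 0`. -/
theorem nu_doubling (w : ℝ) (hw : w ∈ Set.Ioo (0:ℝ) 1) :
    ∃ C : ℝ, 1 ≤ C ∧ ∀ x ∈ cantorK, ∀ r : ℝ, 0 < r →
      nu w (Metric.ball x (2 * r)) ≤ ENNReal.ofReal C * nu w (Metric.ball x r) := by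
  obtain ⟨h0, h1⟩ := hw
  have hm : 0 < min w (1 - w) := lt_min h0 (by linarith)
  have hm1 : min w (1 - w) ≤ 1 := (min_le_left _ _).trans h1.le
  refine ⟨(min w (1 - w) ^ 2)⁻¹, (one_le_inv₀ (by positivity)).2 (pow_le_one₀ hm.le hm1), ?_⟩
  have large : ∀ x ∈ cantorK, ∀ r : ℝ, 1 / 6 < r → nu w (ball x (2 * r)) ≤
      ENNReal.ofReal (min w (1 - w) ^ 2)⁻¹ * nu w (ball x r) := by
    intro x hx r hr
    calc nu w (ball x (2 * r)) ≤ 1 := nu_le_one w measurableSet_ball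
      _ = ENNReal.ofReal (min w (1 - w) ^ 2)⁻¹ * ENNReal.ofReal (min w (1 - w)) ^ 2 := by
        rw [← ENNReal.ofReal_pow hm.le, ← ENNReal.ofReal_mul (by positivity),
          inv_mul_cancel₀ (by positivity), ENNReal.ofReal_one]
      _ ≤ _ := by
        gcongr
        exact sq_le_nu_ball ⟨h0, h1⟩ hx (by linarith)
  have scaled : ∀ n : ℕ, ∀ x ∈ cantorK, ∀ r : ℝ, 1 / 6 < 3 ^ n * r → nu w (ball x (2 * r)) ≤
      ENNReal.ofReal (min w (1 - w) ^ 2)⁻¹ * nu w (ball x r) := by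
    intro n
    induction n with
    | zero => intro x hx r hr; exact large x hx r (by simpa using hr)
    | succ n ih =>
      intro x hx r hr
      rcases lt_or_ge (1 / 6) r with h | h
      · exact large x hx r h
      obtain ⟨b, y, hy, rfl⟩ := cantorK_exists_branch hx
      have hy' := cantorK_subset_Icc hy
      rw [nu_ball_cantorBranch ⟨h0, h1⟩ b hy' (by linarith),
        nu_ball_cantorBranch ⟨h0, h1⟩ b hy' (by linarith), mul_left_comm 3 2 r,
        mul_left_comm (ENNReal.ofReal (min w (1 - w) ^ 2)⁻¹)]
      exact mul_le_mul' le_rfl (ih y hy (3 * r) (by rwa [← mul_assoc, ← pow_succ]))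
  intro x hx r hr
  obtain ⟨n, hn⟩ := pow_unbounded_of_one_lt (1 / 6 / r) (by norm_num : (1 : ℝ) < 3)
  exact scaled n x hx r ((div_lt_iff₀ hr).1 hn)
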